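/- The group ℤ₂ × S₄, the direct product of the cyclic group of order 2 with the symmetric group on 4 letters, is not (1 | 2)-generated; that is, there do not exist elements h₁, h₂ generating ℤ₂ × S₄ such that the commutator h₁h₂h₁⁻¹h₂⁻¹ has order 2. -/

import Mathlib

/-- The Klein four subgroup of `S₄`. -/
def kleinV : Subgroup (Equiv.Perm (Fin 4)) where
  carrier := {σ | σ * σ = 1 ∧ Equiv.Perm.sign σ = 1}
  mul_mem' := by
    have h : ∀ a b : Equiv.Perm (Fin 4), (a * a = 1 ∧ Equiv.Perm.sign a = 1) →
        (b * b = 1 ∧ Equiv.Perm.sign b = 1) → a * b * (a * b) = 1 := by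
      set_option maxRecDepth 100000 in decide
    intro a b ha hb
    exact ⟨h a b ha hb, by rw [map_mul, ha.2, hb.2, one_mul]⟩
  one_mem' := by simp
  inv_mem' := by
    rintro a ⟨h1, h2⟩
    refine ⟨?_, by simpa using h2⟩
    rw [← mul_inv_rev, h1, inv_one]

instance kleinV_normal : kleinV.Normal where
  conj_mem := by
    rintro a ⟨h1, h2⟩ g
    refine ⟨?_, ?_⟩
    · calc g * a * g⁻¹ * (g * a * g⁻¹) = g * (a * a) * g⁻¹ := by group
        _ = 1 := by rw [h1]; group
    · simp [h2]

/-- `ℤ₂ × S₄` is not `(1 | 2)`-generated. -/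
theorem Z2xS4_not_one_two_generated :
    ¬ ∃ h₁ h₂ : Multiplicative (ZMod 2) × Equiv.Perm (Fin 4),
        Subgroup.closure ({h₁, h₂} : Set (Multiplicative (ZMod 2) × Equiv.Perm (Fin 4))) = ⊤ ∧
        orderOf (h₁ * h₂ * h₁⁻¹ * h₂⁻¹) = 2 := by
  rintro ⟨a, b, hgen, hord⟩
  let f : Multiplicative (ZMod 2) × Equiv.Perm (Fin 4) →* Equiv.Perm (Fin 4) ⧸ kleinV :=
    (QuotientGroup.mk' kleinV).comp (MonoidHom.snd _ _)
  have hc : f (a * b * a⁻¹ * b⁻¹) = 1 := by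
    refine (QuotientGroup.eq_one_iff _).2 ⟨?_, ?_⟩
    · have h := pow_orderOf_eq_one (a * b * a⁻¹ * b⁻¹)
      rw [hord, pow_two] at h
      exact congrArg Prod.snd h
    · change Equiv.Perm.sign (a.2 * b.2 * a.2⁻¹ * b.2⁻¹) = 1
      rw [map_mul, map_mul, map_mul, map_inv, map_inv, mul_inv_eq_one, mul_inv_eq_iff_eq_mul]
      exact mul_comm _ _
  have hab : f a * f b = f b * f a := by
    rw [map_mul, map_mul, map_mul, map_inv, map_inv, mul_inv_eq_one, mul_inv_eq_iff_eq_mul] at hc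
    exact hc
  have key : ∀ x, f a * x = x * f a → f b * x = x * f b → ∀ g, f g * x = x * f g := by
    intro x h1 h2 g
    have hg : g ∈ Subgroup.closure {a, b} := by rw [hgen]; trivial
    have hle : Subgroup.closure {a, b} ≤ (Subgroup.centralizer {x}).comap f := by
      rw [Subgroup.closure_le]
      rintro y (rfl | rfl)
      · exact Subgroup.mem_centralizer_singleton_iff.2 (by first | exact h1 | exact h1.symm)
      · exact Subgroup.mem_centralizer_singleton_iff.2 (by first | exact h2 | exact h2.symm)
    have := Subgroup.mem_centralizer_singleton_iff.1 (hle hg)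
    first | exact this | exact this.symm
  have ha := key (f a) rfl hab.symm
  have hb := key (f b) hab rfl
  have hall : ∀ g k, f g * f k = f k * f g := fun g k =>
    key (f k) (ha k).symm (hb k).symm g
  have h := hall (1, Equiv.swap 0 1) (1, Equiv.swap 1 2)
  rw [← map_mul, ← map_mul] at h
  have h2 := (QuotientGroup.eq.1 h).1
  revert h2
  decide
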